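/- For real t ≠ 0 and x ∈ ℝ, the one-dimensional propagated basis function φ_{2M}(x,t) = (πit)^{-1/2} ∫_ℝ e^{i(x−y)²/t} χ_{2M}(y) dy equals (1/√π) Σ_{ℓ=0}^{M−1} ((−1)^ℓ/(ℓ! 4^ℓ)) (1+it)^{−ℓ−1/2} e^{−x²/(1+it)} H_{2ℓ}(x/√(1+it)). -/

import Mathlib

open MeasureTheory

/-- Physicists' Hermite polynomials, via `H_0 = 1`, `H_{k+1}(x) = 2x H_k(x) - H_k'(x)`. -/
noncomputable def hermitePoly : ℕ → Polynomial ℤ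
  | 0 => 1
  | k + 1 => 2 * Polynomial.X * hermitePoly k - Polynomial.derivative (hermitePoly k)

/-- The one-dimensional generating function
`χ_{2M}(y) = ((-1)^{M-1}/(2^{2M-1} √π (M-1)!)) H_{2M-1}(y) e^{-y²} / y`. -/
noncomputable def chiFun (M : ℕ) (y : ℝ) : ℝ :=
  ((-1) ^ (M - 1) / (2 ^ (2 * M - 1) * Real.sqrt Real.pi * (Nat.factorial (M - 1)))) *
    Polynomial.aeval y (hermitePoly (2 * M - 1)) * Real.exp (-y ^ 2) / y

lemma herm_succ (n : ℕ) : hermitePoly (n + 1) =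
    2 * Polynomial.X * hermitePoly n - Polynomial.derivative (hermitePoly n) := rfl

lemma herm_deriv (n : ℕ) : Polynomial.derivative (hermitePoly (n + 1)) =
    2 * ((n : Polynomial ℤ) + 1) * hermitePoly n := by
  induction n with
  | zero => simp [hermitePoly]
  | succ n ih =>
    have h2 : Polynomial.derivative (2 : Polynomial ℤ) = 0 := Polynomial.derivative_ofNat 2
    have hn : Polynomial.derivative ((n : Polynomial ℤ)) = 0 := Polynomial.derivative_natCast
    rw [herm_succ (n + 1)]
    simp only [Polynomial.derivative_sub, Polynomial.derivative_mul, ih, Polynomial.derivative_X,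
      Polynomial.derivative_add, Polynomial.derivative_one, h2, hn]
    have := herm_succ n
    rw [this]
    push_cast
    ring

lemma aeval_two (z : ℂ) : Polynomial.aeval z (2 : Polynomial ℤ) = 2 :=
  map_ofNat (Polynomial.aeval z) 2

/-- evaluation recursion -/
lemma herm_rec (n : ℕ) (z : ℂ) : Polynomial.aeval z (hermitePoly (n + 2)) =
    2 * z * Polynomial.aeval z (hermitePoly (n + 1))
      - 2 * ((n : ℂ) + 1) * Polynomial.aeval z (hermitePoly n) := by
  rw [herm_succ (n + 1), herm_deriv]
  simp [aeval_two]

lemma chi_sum (M : ℕ) (z : ℂ) (hz : z ≠ 0) :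
    ((-1) ^ M / (2 ^ (2 * M + 1) * (Nat.factorial M : ℂ))) *
      Polynomial.aeval z (hermitePoly (2 * M + 1)) / z =
    ∑ l ∈ Finset.range (M + 1), ((-1) ^ l / ((Nat.factorial l : ℂ) * 4 ^ l)) *
      Polynomial.aeval z (hermitePoly (2 * l)) := by
  induction M with
  | zero => simp [hermitePoly, aeval_two, hz]
  | succ M ih =>
    rw [Finset.sum_range_succ, ← ih]
    have h := herm_rec (2 * M + 1) z
    have e : 2 * (M + 1) + 1 = 2 * M + 1 + 2 := by ring
    rw [e, h, show 2 * M + 1 + 1 = 2 * (M + 1) by ring, Nat.factorial_succ]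
    have h1 : (Nat.factorial M : ℂ) ≠ 0 := by exact_mod_cast Nat.factorial_ne_zero M
    have h2 : (M : ℂ) + 1 ≠ 0 := by exact_mod_cast Nat.succ_ne_zero M
    have h4 : (4 : ℂ) ^ (M + 1) = 2 ^ (2 * M + 2) := by
      rw [show 2 * M + 2 = 2 * (M + 1) by ring, pow_mul]; norm_num
    rw [h4]
    push_cast
    field_simp
    ring

lemma int_poly (x t : ℝ) (P : Polynomial ℂ) : Integrable (fun y : ℝ =>
    P.eval (y : ℂ) * Complex.exp (Complex.I * ((x : ℂ) - y) ^ 2 / t - (y : ℂ) ^ 2)) := by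
  simp only [Polynomial.eval_eq_sum_range, Finset.sum_mul]
  refine integrable_finsetSum _ fun k _ => ?_
  simp only [mul_assoc]
  refine Integrable.const_mul ?_ _
  have h := integrable_rpow_mul_exp_neg_mul_sq (b := 1) one_pos (s := k)
    (by have : (0 : ℝ) ≤ k := by positivity
        linarith)
  refine h.mono (by fun_prop) (Filter.Eventually.of_forall fun y => ?_)
  rw [norm_mul, norm_mul, Real.rpow_natCast, Complex.norm_exp]
  apply le_of_eq
  congr 1
  · simp
  · rw [Real.norm_eq_abs, abs_of_pos (Real.exp_pos _)]
    congr 1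
    have : Complex.I * ((x : ℂ) - y) ^ 2 / t - (y : ℂ) ^ 2 =
        ((-1 * y ^ 2 : ℝ) : ℂ) + (((x - y) ^ 2 / t : ℝ) : ℂ) * Complex.I := by
      push_cast; ring
    rw [this, Complex.add_re, Complex.ofReal_re, Complex.re_ofReal_mul]
    simp

lemma int_zero (x t : ℝ) (P : Polynomial ℂ) : ∫ y : ℝ,
    (Polynomial.derivative P + P * (Polynomial.C (2 * Complex.I / t - 2) * Polynomial.X -
      Polynomial.C (2 * Complex.I * x / t))).eval (y : ℂ) *
      Complex.exp (Complex.I * ((x : ℂ) - y) ^ 2 / t - (y : ℂ) ^ 2) = 0 := by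
  refine integral_eq_zero_of_hasDerivAt_of_integrable (f := fun y : ℝ =>
    P.eval (y : ℂ) * Complex.exp (Complex.I * ((x : ℂ) - y) ^ 2 / t - (y : ℂ) ^ 2))
    (fun y => ?_) (int_poly x t _) (int_poly x t P)
  have h1 : HasDerivAt (fun z : ℂ => P.eval z *
      Complex.exp (Complex.I * ((x : ℂ) - z) ^ 2 / t - z ^ 2))
      ((Polynomial.derivative P + P * (Polynomial.C (2 * Complex.I / t - 2) * Polynomial.X -
      Polynomial.C (2 * Complex.I * x / t))).eval (y : ℂ) *
      Complex.exp (Complex.I * ((x : ℂ) - y) ^ 2 / t - (y : ℂ) ^ 2)) (y : ℂ) := by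
    have h3 : HasDerivAt (fun z : ℂ => Complex.I * ((x : ℂ) - z) ^ 2 / t - z ^ 2)
        (Complex.I * (2 * ((x : ℂ) - y) * (-1)) / t - 2 * y) (y : ℂ) := by
      have h4 := ((((hasDerivAt_id (y : ℂ)).const_sub (x : ℂ)).pow 2).const_mul
        Complex.I).div_const (t : ℂ)
      have h5 := h4.sub ((hasDerivAt_id (y : ℂ)).pow 2)
      exact h5.congr_deriv (by simp)
    refine ((P.hasDerivAt (y : ℂ)).mul h3.cexp).congr_deriv ?_
    simp only [Polynomial.eval_add, Polynomial.eval_mul, Polynomial.eval_sub, Polynomial.eval_C,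
      Polynomial.eval_X]
    ring
  exact h1.comp_ofReal

/-- The moments. -/
noncomputable def Jm (x t : ℝ) (n : ℕ) : ℂ := ∫ y : ℝ,
  Polynomial.aeval (y : ℂ) (hermitePoly n) *
    Complex.exp (Complex.I * ((x : ℂ) - y) ^ 2 / t - (y : ℂ) ^ 2)

lemma aeval_map' (z : ℂ) (p : Polynomial ℤ) :
    (p.map (Int.castRingHom ℂ)).eval z = Polynomial.aeval z p := by
  rw [Polynomial.aeval_def, Polynomial.eval_map]; rfl

lemma int_herm (x t : ℝ) (n : ℕ) : Integrable (fun y : ℝ =>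
    Polynomial.aeval (y : ℂ) (hermitePoly n) *
    Complex.exp (Complex.I * ((x : ℂ) - y) ^ 2 / t - (y : ℂ) ^ 2)) := by
  simpa only [aeval_map'] using int_poly x t ((hermitePoly n).map (Int.castRingHom ℂ))

lemma Jm_one (x t : ℝ) (ht : t ≠ 0) :
    (1 + Complex.I * t) * Jm x t 1 = 2 * x * Jm x t 0 := by
  have h := int_zero x t 1
  have ht' : (t : ℂ) ≠ 0 := by exact_mod_cast ht
  have e : (Complex.I / t - 1) * Jm x t 1 + (-(2 * Complex.I * x / t)) * Jm x t 0 = 0 := by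
    rw [← h, Jm, Jm, ← integral_const_mul, ← integral_const_mul, ← integral_add
      ((int_herm x t 1).const_mul _) ((int_herm x t 0).const_mul _)]
    congr 1
    ext y
    simp [hermitePoly, aeval_two]
    ring
  field_simp at e
  linear_combination -Complex.I * e + (Jm x t 1 - 2 * x * Jm x t 0) * Complex.I_sq

lemma Jm_rec (x t : ℝ) (ht : t ≠ 0) (n : ℕ) :
    (1 + Complex.I * t) * Jm x t (n + 2) = 2 * x * Jm x t (n + 1) -
      2 * ((n : ℂ) + 1) * Jm x t n := by
  have h := int_zero x t ((hermitePoly (n + 1)).map (Int.castRingHom ℂ))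
  have ht' : (t : ℂ) ≠ 0 := by exact_mod_cast ht
  have e : (Complex.I / t - 1) * Jm x t (n + 2) + ((-(2 * Complex.I * x / t)) * Jm x t (n + 1)
      + (2 * ((n : ℂ) + 1) * Complex.I / t) * Jm x t n) = 0 := by
    rw [← h, Jm, Jm, Jm, ← integral_const_mul, ← integral_const_mul, ← integral_const_mul,
      ← integral_add ((int_herm x t (n + 1)).const_mul _) ((int_herm x t n).const_mul _),
      ← integral_add ((int_herm x t (n + 2)).const_mul _)
        (by exact ((int_herm x t (n + 1)).const_mul _).add ((int_herm x t n).const_mul _))]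
    congr 1
    ext y
    simp only [Polynomial.eval_add, Polynomial.eval_mul, Polynomial.eval_sub, Polynomial.eval_C,
      Polynomial.eval_X, Polynomial.derivative_map, aeval_map', herm_deriv, herm_rec]
    simp [aeval_two]
    ring
  field_simp at e
  linear_combination -Complex.I * e + (Jm x t (n + 2) - 2 * x * Jm x t (n + 1)
    + 2 * (n + 1) * Jm x t n) * Complex.I_sq

lemma Jm_eq (x t : ℝ) (ht : t ≠ 0) (s : ℂ) (hs : s ^ 2 = 1 + Complex.I * t) (hs0 : s ≠ 0)
    (n : ℕ) : Jm x t n * s ^ n = Jm x t 0 * Polynomial.aeval ((x : ℂ) / s) (hermitePoly n) := by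
  induction n using Nat.strong_induction_on with
  | _ n ih =>
    match n with
    | 0 => simp [hermitePoly]
    | 1 =>
      have h := Jm_one x t ht
      rw [← hs] at h
      have : Polynomial.aeval ((x : ℂ) / s) (hermitePoly 1) = 2 * (x / s) := by
        simp [hermitePoly, aeval_two]
      rw [this]
      field_simp
      linear_combination h
    | k + 2 =>
      have h := Jm_rec x t ht k
      have h0 := ih k (by omega)
      have h1 := ih (k + 1) (by omega)
      rw [← hs] at h
      rw [herm_rec]
      have : Jm x t 0 * (2 * ((x : ℂ) / s) * Polynomial.aeval ((x : ℂ) / s) (hermitePoly (k + 1))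
          - 2 * ((k : ℂ) + 1) * Polynomial.aeval ((x : ℂ) / s) (hermitePoly k))
          = 2 * (x / s) * (Jm x t (k + 1) * s ^ (k + 1)) - 2 * (k + 1) * (Jm x t k * s ^ k) := by
        rw [h0, h1]; ring
      rw [this]
      have e : 2 * ((x : ℂ) / s) * (Jm x t (k + 1) * s ^ (k + 1)) =
        2 * x * Jm x t (k + 1) * s ^ k := by
        rw [pow_succ]; field_simp
      rw [e]
      linear_combination s ^ k * h

lemma Jm_zero (x t : ℝ) (ht : t ≠ 0) :
    (Real.pi * Complex.I * t) ^ (-(1 : ℂ) / 2) * Jm x t 0 =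
      (1 + Complex.I * t) ^ (-(1 : ℂ) / 2) * Complex.exp (-(x : ℂ) ^ 2 / (1 + Complex.I * t)) := by
  have ht' : (t : ℂ) ≠ 0 := by exact_mod_cast ht
  have hw : (1 + Complex.I * t) ≠ 0 := by
    intro h
    have := congrArg Complex.re h
    simp at this
  have hpi : (Real.pi : ℂ) ≠ 0 := by exact_mod_cast Real.pi_ne_zero
  have hbre : (Complex.I / t - 1 : ℂ) = ((-1 : ℝ) : ℂ) + ((1 / t : ℝ) : ℂ) * Complex.I := by
    push_cast; ring
  have hb : (Complex.I / t - 1 : ℂ).re < 0 := by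
    rw [hbre, Complex.add_re, Complex.re_ofReal_mul]; simp
  have hb0 : (Complex.I / t - 1 : ℂ) ≠ 0 := by
    intro h; rw [h] at hb; simp at hb
  have h := integral_cexp_quadratic hb (-2 * Complex.I * x / t) (Complex.I * x ^ 2 / t)
  have hJ : Jm x t 0 = ∫ y : ℝ, Complex.exp ((Complex.I / t - 1) * y ^ 2 +
      (-2 * Complex.I * x / t) * y + Complex.I * x ^ 2 / t) := by
    rw [Jm]
    congr 1
    ext y
    simp only [hermitePoly, map_one, one_mul]
    congr 1
    ring
  rw [hJ, h, ← mul_assoc]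
  congr 1
  ·
    have key : (1 + Complex.I * t) * (Real.pi / -(Complex.I / t - 1)) = Real.pi * Complex.I * t := by
      have : -(Complex.I / t - 1) ≠ 0 := neg_ne_zero.mpr hb0
      rw [mul_div_assoc', div_eq_iff this]
      field_simp
      linear_combination Complex.I_sq
    set w := (1 + Complex.I * (t : ℂ)) with hwdef
    set q := (Real.pi / -(Complex.I / t - 1) : ℂ) with hq
    have hq0 : q ≠ 0 := div_ne_zero hpi (neg_ne_zero.mpr hb0)
    have hwre : 0 < w.re := by simp [hwdef]
    have hqre : 0 < q.re := by
      have hinv : q = ((Real.pi : ℝ) : ℂ) * (-(Complex.I / t - 1))⁻¹ := div_eq_mul_inv _ _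
      rw [hinv, Complex.re_ofReal_mul, Complex.inv_re]
      refine mul_pos Real.pi_pos (div_pos ?_ (Complex.normSq_pos.mpr (neg_ne_zero.mpr hb0)))
      rw [Complex.neg_re]; linarith
    have a1 := abs_lt.mp (Complex.abs_arg_lt_pi_div_two_iff.mpr (Or.inl hwre))
    have a2 := abs_lt.mp (Complex.abs_arg_lt_pi_div_two_iff.mpr (Or.inl hqre))
    have hmul : (w * q) ^ (-(1 : ℂ) / 2) = w ^ (-(1 : ℂ) / 2) * q ^ (-(1 : ℂ) / 2) := by
      rw [Complex.cpow_def_of_ne_zero (mul_ne_zero hw hq0), Complex.cpow_def_of_ne_zero hw,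
        Complex.cpow_def_of_ne_zero hq0, Complex.log_mul hw hq0 ⟨by linarith, by linarith⟩,
        add_mul, Complex.exp_add]
    rw [← key, hmul, mul_assoc,
      ← Complex.cpow_add _ _ hq0]
    norm_num
  · congr 1
    have h4 : 4 * (Complex.I / t - 1 : ℂ) ≠ 0 := mul_ne_zero (by norm_num) hb0
    have hI : (Complex.I - t : ℂ) ≠ 0 := by
      intro h0; apply hb0; rw [sub_eq_zero] at h0; rw [h0]; field_simp; ring
    have e : (Complex.I / t - 1 : ℂ) = (Complex.I - t) / t := by field_simp
    rw [e]
    field_simp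
    ring_nf
    simp only [Complex.I_sq]
    ring_nf

theorem stmt11 (M : ℕ) (hM : 1 ≤ M) (t : ℝ) (ht : t ≠ 0) (x : ℝ) :
    (Real.pi * Complex.I * t) ^ (-(1 : ℂ) / 2) *
        ∫ y : ℝ, Complex.exp (Complex.I * ((x : ℂ) - y) ^ 2 / t) * (chiFun M y : ℂ)
      = (1 / (Real.sqrt Real.pi : ℂ)) *
          ∑ ℓ ∈ Finset.range M,
            ((-1) ^ ℓ / ((Nat.factorial ℓ : ℂ) * 4 ^ ℓ)) *
              (1 + Complex.I * t) ^ (-(ℓ : ℂ) - 1 / 2) *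
              Complex.exp (-(x : ℂ) ^ 2 / (1 + Complex.I * t)) *
              Polynomial.aeval ((x : ℂ) / (1 + Complex.I * t) ^ ((1 : ℂ) / 2))
                (hermitePoly (2 * ℓ)) := by
  obtain ⟨N, rfl⟩ : ∃ N, M = N + 1 := ⟨M - 1, by omega⟩
  have hw : (1 + Complex.I * t) ≠ 0 := by
    intro h
    have := congrArg Complex.re h
    simp at this
  have hs : ((1 + Complex.I * t) ^ ((1 : ℂ) / 2)) ^ 2 = 1 + Complex.I * t := by
    rw [← Complex.cpow_nat_mul]; norm_num
  have hs0 : (1 + Complex.I * t) ^ ((1 : ℂ) / 2) ≠ 0 := by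
    intro h; rw [h] at hs; apply hw; rw [← hs]; norm_num
  have hInt : ∫ y : ℝ, Complex.exp (Complex.I * ((x : ℂ) - y) ^ 2 / t) * (chiFun (N + 1) y : ℂ)
      = (1 / (Real.sqrt Real.pi : ℂ)) * ∑ l ∈ Finset.range (N + 1),
        ((-1) ^ l / ((Nat.factorial l : ℂ) * 4 ^ l)) * Jm x t (2 * l) := by
    simp only [Jm, ← integral_const_mul]
    rw [← integral_finsetSum _ (fun l _ => (int_herm x t (2 * l)).const_mul _),
      ← integral_const_mul]
    apply integral_congr_ae
    have h0 : ∀ᵐ y : ℝ, y ≠ 0 := by simp [ae_iff]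
    filter_upwards [h0] with y hy
    have hc := chi_sum N (y : ℂ) (by exact_mod_cast hy)
    have hr : (chiFun (N + 1) y : ℂ) = (1 / (Real.sqrt Real.pi : ℂ)) *
        (((-1) ^ N / (2 ^ (2 * N + 1) * (Nat.factorial N : ℂ))) *
      Polynomial.aeval (y : ℂ) (hermitePoly (2 * N + 1)) / y) * Complex.exp (-(y : ℂ) ^ 2) := by
      have ha : ((Polynomial.aeval y (hermitePoly (2 * N + 1)) : ℝ) : ℂ) =
          Polynomial.aeval (y : ℂ) (hermitePoly (2 * N + 1)) :=
        (Polynomial.aeval_algebraMap_apply ℂ y (hermitePoly (2 * N + 1))).symm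
      have hsp : (Real.sqrt Real.pi : ℂ) ≠ 0 := by
        exact_mod_cast (Real.sqrt_pos.mpr Real.pi_pos).ne'
      simp only [chiFun, show N + 1 - 1 = N by omega, show 2 * (N + 1) - 1 = 2 * N + 1 by omega]
      push_cast
      rw [ha]
      field_simp
    rw [hr, hc, sub_eq_add_neg (Complex.I * ((x : ℂ) - y) ^ 2 / t), Complex.exp_add, Finset.mul_sum, Finset.mul_sum, Finset.sum_mul,
      Finset.mul_sum]
    refine Finset.sum_congr rfl fun l _ => ?_
    ring
  rw [hInt, mul_left_comm, Finset.mul_sum]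
  congr 1
  refine Finset.sum_congr rfl fun l _ => ?_
  have hJ := Jm_eq x t ht _ hs hs0 (2 * l)
  rw [pow_mul, hs] at hJ
  have hz := Jm_zero x t ht
  have hp : (1 + Complex.I * t : ℂ) ^ (-(l : ℂ) - 1 / 2) * (1 + Complex.I * t) ^ l =
      (1 + Complex.I * t) ^ (-(1 : ℂ) / 2) := by
    rw [← Complex.cpow_natCast, ← Complex.cpow_add _ _ hw]
    congr 1
    ring
  have hwl : (1 + Complex.I * t : ℂ) ^ l ≠ 0 := pow_ne_zero _ hw
  apply mul_right_cancel₀ hwl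
  rw [← hp] at hz
  linear_combination (((-1) ^ l / ((Nat.factorial l : ℂ) * 4 ^ l))) *
    ((Real.pi * Complex.I * t) ^ (-(1 : ℂ) / 2) * hJ + Polynomial.aeval ((x : ℂ) /
      (1 + Complex.I * t) ^ ((1 : ℂ) / 2)) (hermitePoly (2 * l)) * hz)
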